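/- (Lemma 2 of the paper.) Assume the PEA setup and suppose r* ∈ R_b satisfies M_f(r*) = E(r*). Then for all prices r₁, r₂ ∈ R_b with r* ≤ r₁ < r₂: M_f(r₁) = E(r₁), M_f(r₂) = E(r₂), and M_f(r₁) > M_f(r₂). -/

import Mathlib

/-- The set of selected workers of a partial assignment `x`. -/
def selected {n m : ℕ} (x : Fin n → Option (Fin m)) : Finset (Fin n) :=
  Finset.univ.filter fun i => x i ≠ none

/-- `x` is compatibility-feasible on `S`: every selected worker lies in `S`, and for each
group `l` and requester `j`, at most `τ l j` workers of group `l` are assigned to `j`. -/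
def CompatFeasible {n m L : ℕ} (g : Fin n → Fin L) (τ : Fin L → Fin m → ℕ)
    (S : Finset (Fin n)) (x : Fin n → Option (Fin m)) : Prop :=
  (∀ i, x i ≠ none → i ∈ S) ∧
  ∀ (l : Fin L) (j : Fin m),
    (Finset.univ.filter fun i => g i = l ∧ x i = some j).card ≤ τ l j

lemma compatFeasible_none {n m L : ℕ} (g : Fin n → Fin L) (τ : Fin L → Fin m → ℕ)
    (S : Finset (Fin n)) : CompatFeasible g τ S (fun _ => (none : Option (Fin m))) := by
  refine ⟨fun i h => absurd rfl h, fun l j => ?_⟩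
  simp

open Classical in
/-- `Mv g τ v S`: the optimal overall reputation over compatibility-feasible assignments
on `S`. -/
noncomputable def Mv {n m L : ℕ} (g : Fin n → Fin L) (τ : Fin L → Fin m → ℕ)
    (v : Fin n → ℝ) (S : Finset (Fin n)) : ℝ :=
  (Finset.univ.filter fun x : Fin n → Option (Fin m) => CompatFeasible g τ S x).sup'
    ⟨fun _ => none, Finset.mem_filter.mpr ⟨Finset.mem_univ _, compatFeasible_none g τ S⟩⟩
    fun x => ∑ i ∈ selected x, v i

/-- The set of the first `j` workers (0-indexed: workers `0, …, j-1`). -/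
def firstWorkers (n j : ℕ) : Finset (Fin n) := Finset.univ.filter fun i => (i : ℕ) < j

/-- `x` is cap-feasible on `S` with capacities `c`: compatibility-feasible on `S` and
each requester `j` receives at most `c j` workers. -/
def CapFeasible {n m L : ℕ} (g : Fin n → Fin L) (τ : Fin L → Fin m → ℕ)
    (c : Fin m → ℕ) (S : Finset (Fin n)) (x : Fin n → Option (Fin m)) : Prop :=
  CompatFeasible g τ S x ∧
  ∀ j : Fin m, (Finset.univ.filter fun i => x i = some j).card ≤ c j

open Classical in
/-- `Nc g τ c S`: the maximum number of selected workers over cap-feasible assignments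
on `S`. -/
noncomputable def Nc {n m L : ℕ} (g : Fin n → Fin L) (τ : Fin L → Fin m → ℕ)
    (c : Fin m → ℕ) (S : Finset (Fin n)) : ℕ :=
  (Finset.univ.filter fun x : Fin n → Option (Fin m) => CapFeasible g τ c S x).sup
    fun x => (selected x).card
/-- The virtual price set `R_b = {B_j / t : j ∈ Fin m, t ∈ {1,…,n}}`. -/
noncomputable def Rb {m : ℕ} (Bg : Fin m → ℝ) (n : ℕ) : Finset ℝ :=
  (Finset.univ : Finset (Fin m × Fin n)).image fun p => Bg p.1 / ((p.2 : ℕ) + 1)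

/-- The employability at price `r`: `E(r) = ∑_j ⌊B_j / r⌋`. -/
noncomputable def employ {m : ℕ} (Bg : Fin m → ℝ) (r : ℝ) : ℕ :=
  ∑ j : Fin m, (⌊Bg j / r⌋).toNat

/-- The available worker set at price `r`: workers whose bids are at most `r`. -/
noncomputable def avail {n : ℕ} (b : Fin n → ℝ) (r : ℝ) : Finset (Fin n) :=
  Finset.univ.filter fun i => b i ≤ r

/-- `M_f(r)`: the maximum number of workers assignable at price `r`, i.e. the optimal
cap-feasible count on the available set `S(r)` with caps `c_r(j) = ⌊B_j / r⌋`. -/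
noncomputable def Mf {n m L : ℕ} (g : Fin n → Fin L) (τ : Fin L → Fin m → ℕ)
    (Bg : Fin m → ℝ) (b : Fin n → ℝ) (r : ℝ) : ℕ :=
  Nc g τ (fun j => (⌊Bg j / r⌋).toNat) (avail b r)

lemma card_selected_eq_sum {n m : ℕ} (x : Fin n → Option (Fin m)) :
    (selected x).card = ∑ j : Fin m, (Finset.univ.filter fun i => x i = some j).card := by
  classical
  have h : selected x = Finset.univ.biUnion fun j : Fin m =>
      Finset.univ.filter fun i => x i = some j := by
    ext i
    simp [selected, Option.ne_none_iff_exists']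
  rw [h, Finset.card_biUnion]
  intro j _ k _ hjk
  rw [Function.onFun, Finset.disjoint_left]
  intro i hj hk
  simp only [Finset.mem_filter, Finset.mem_univ, true_and] at hj hk
  exact hjk (Option.some.inj (hj.symm.trans hk))

lemma card_selected_le_sum {n m L : ℕ} {g : Fin n → Fin L} {τ : Fin L → Fin m → ℕ}
    {c : Fin m → ℕ} {S : Finset (Fin n)} {x : Fin n → Option (Fin m)}
    (hx : CapFeasible g τ c S x) : (selected x).card ≤ ∑ j, c j := by
  rw [card_selected_eq_sum]
  exact Finset.sum_le_sum fun j _ => hx.2 j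

lemma Nc_le_sum {n m L : ℕ} (g : Fin n → Fin L) (τ : Fin L → Fin m → ℕ)
    (c : Fin m → ℕ) (S : Finset (Fin n)) : Nc g τ c S ≤ ∑ j, c j := by
  classical
  exact Finset.sup_le fun x hx => card_selected_le_sum (Finset.mem_filter.mp hx).2

lemma card_selected_le_Nc {n m L : ℕ} {g : Fin n → Fin L} {τ : Fin L → Fin m → ℕ}
    {c : Fin m → ℕ} {S : Finset (Fin n)} {x : Fin n → Option (Fin m)}
    (hx : CapFeasible g τ c S x) : (selected x).card ≤ Nc g τ c S := by
  classical
  exact Finset.le_sup (f := fun x => (selected x).card)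
    (Finset.mem_filter.mpr ⟨Finset.mem_univ x, hx⟩)

lemma exists_capFeasible_card_eq_Nc {n m L : ℕ} (g : Fin n → Fin L)
    (τ : Fin L → Fin m → ℕ) (c : Fin m → ℕ) (S : Finset (Fin n)) :
    ∃ x, CapFeasible g τ c S x ∧ (selected x).card = Nc g τ c S := by
  classical
  have hne : (Finset.univ.filter fun x : Fin n → Option (Fin m) =>
      CapFeasible g τ c S x).Nonempty :=
    ⟨fun _ => none, Finset.mem_filter.mpr ⟨Finset.mem_univ _,
      compatFeasible_none g τ S, fun j => by simp⟩⟩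
  obtain ⟨x, hx, h⟩ := Finset.exists_mem_eq_sup _ hne fun x => (selected x).card
  refine ⟨x, (Finset.mem_filter.mp hx).2, ?_⟩
  rw [Nc]
  convert h.symm

/-- If all capacities can be saturated, this remains true after lowering the capacities and
enlarging the set of available workers. -/
lemma Nc_eq_sum_of_le {n m L : ℕ} {g : Fin n → Fin L} {τ : Fin L → Fin m → ℕ}
    {c c' : Fin m → ℕ} {S S' : Finset (Fin n)} (hc : ∀ j, c' j ≤ c j) (hS : S ⊆ S')
    (h : Nc g τ c S = ∑ j, c j) : Nc g τ c' S' = ∑ j, c' j := by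
  classical
  obtain ⟨x, hx, hcard⟩ := exists_capFeasible_card_eq_Nc g τ c S
  rw [h, card_selected_eq_sum] at hcard
  have hfull := (Finset.sum_eq_sum_iff_of_le fun j _ => hx.2 j).mp hcard
  have hT : ∀ j, ∃ T ⊆ Finset.univ.filter fun i => x i = some j, T.card = c' j := fun j =>
    Finset.exists_subset_card_eq ((hc j).trans (hfull j (Finset.mem_univ j)).ge)
  choose T hTsub hTcard using hT
  have hTx : ∀ j, ∀ i ∈ T j, x i = some j := fun j i hi =>
    (Finset.mem_filter.mp (hTsub j hi)).2
  let y : Fin n → Option (Fin m) := fun i => (x i).filter fun j => decide (i ∈ T j)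
  have hy : ∀ i j, y i = some j ↔ i ∈ T j := by
    intro i j
    simp only [y, Option.filter_eq_some_iff, decide_eq_true_eq]
    exact ⟨fun h => h.2, fun h => ⟨hTx j i h, h⟩⟩
  have hyx : ∀ i j, y i = some j → x i = some j := fun i j hij => hTx j i ((hy i j).mp hij)
  have hfib : ∀ j, (Finset.univ.filter fun i => y i = some j).card = c' j := by
    intro j
    rw [← hTcard j]
    congr 1
    ext i
    simp [hy]
  have hfeas : CapFeasible g τ c' S' y := by
    refine ⟨⟨fun i hi => ?_, fun l j => ?_⟩, fun j => (hfib j).le⟩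
    · obtain ⟨j, hj⟩ := Option.ne_none_iff_exists'.mp hi
      exact hS (hx.1.1 i (by simp [hyx i j hj]))
    · refine (Finset.card_le_card ?_).trans (hx.1.2 l j)
      exact Finset.monotone_filter_right _ fun i _ hi => ⟨hi.1, hyx i j hi.2⟩
  refine (Nc_le_sum g τ c' S').antisymm ?_
  calc ∑ j, c' j = (selected y).card := by simp only [card_selected_eq_sum, hfib]
    _ ≤ Nc g τ c' S' := card_selected_le_Nc hfeas

lemma toNat_floor_div_anti {B r s : ℝ} (hB : 0 < B) (hr : 0 < r) (hrs : r ≤ s) :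
    (⌊B / s⌋).toNat ≤ (⌊B / r⌋).toNat :=
  Int.toNat_le_toNat (Int.floor_le_floor (by gcongr))

lemma avail_mono {n : ℕ} (b : Fin n → ℝ) {r s : ℝ} (hrs : r ≤ s) :
    avail b r ⊆ avail b s :=
  Finset.monotone_filter_right _ fun _ _ hi => le_trans hi hrs

lemma Mf_eq_employ_of_le {n m L : ℕ} {g : Fin n → Fin L} {τ : Fin L → Fin m → ℕ}
    {Bg : Fin m → ℝ} (hBg : ∀ j, 0 < Bg j) {b : Fin n → ℝ} {r s : ℝ} (hr : 0 < r)
    (hrs : r ≤ s) (h : Mf g τ Bg b r = employ Bg r) : Mf g τ Bg b s = employ Bg s :=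
  Nc_eq_sum_of_le (fun j => toNat_floor_div_anti (hBg j) hr hrs) (avail_mono b hrs) h

lemma pos_of_mem_Rb {n m : ℕ} {Bg : Fin m → ℝ} (hBg : ∀ j, 0 < Bg j) {r : ℝ}
    (hr : r ∈ Rb Bg n) : 0 < r := by
  obtain ⟨⟨j, t⟩, -, rfl⟩ := Finset.mem_image.mp hr
  have := hBg j
  positivity

lemma employ_lt_of_mem_Rb {n m : ℕ} {Bg : Fin m → ℝ} (hBg : ∀ j, 0 < Bg j) {r s : ℝ}
    (hr : r ∈ Rb Bg n) (hrs : r < s) : employ Bg s < employ Bg r := by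
  have hr0 := pos_of_mem_Rb hBg hr
  refine Finset.sum_lt_sum (fun j _ => toNat_floor_div_anti (hBg j) hr0 hrs.le) ?_
  obtain ⟨⟨j, t⟩, -, hjt⟩ := Finset.mem_image.mp hr
  dsimp only at hjt
  have hdiv : Bg j / r = (((t : ℕ) + 1 : ℤ) : ℝ) := by
    rw [← hjt, div_div_cancel₀ (hBg j).ne']
    push_cast
    rfl
  have hlt : ⌊Bg j / s⌋ < (t : ℕ) + 1 := by
    rw [Int.floor_lt, ← hdiv]
    exact div_lt_div_of_pos_left (hBg j) hr0 hrs
  refine ⟨j, Finset.mem_univ j, ?_⟩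
  rw [hdiv, Int.floor_intCast]
  omega

/-- Lemma 2 of the paper: in the PEA setup, if `r* ∈ R_b` satisfies `M_f(r*) = E(r*)`,
then for all prices `r₁, r₂ ∈ R_b` with `r* ≤ r₁ < r₂` we have `M_f(r₁) = E(r₁)`,
`M_f(r₂) = E(r₂)`, and `M_f(r₁) > M_f(r₂)`. -/
theorem lemma2_Mf_decreasing
    {n m L : ℕ} (g : Fin n → Fin L) (τ : Fin L → Fin m → ℕ)
    (Bg : Fin m → ℝ) (hBg : ∀ j, 0 < Bg j)
    (b : Fin n → ℝ) (hb : ∀ i, 0 < b i)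
    (rstar : ℝ) (hmem : rstar ∈ Rb Bg n)
    (hstar : Mf g τ Bg b rstar = employ Bg rstar)
    (r₁ r₂ : ℝ) (h₁ : r₁ ∈ Rb Bg n) (h₂ : r₂ ∈ Rb Bg n)
    (hr₁ : rstar ≤ r₁) (h₁₂ : r₁ < r₂) :
    Mf g τ Bg b r₁ = employ Bg r₁ ∧ Mf g τ Bg b r₂ = employ Bg r₂ ∧
      Mf g τ Bg b r₂ < Mf g τ Bg b r₁ := by
  have hpos := pos_of_mem_Rb hBg hmem
  have e₁ := Mf_eq_employ_of_le hBg hpos hr₁ hstar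
  have e₂ := Mf_eq_employ_of_le hBg hpos (hr₁.trans h₁₂.le) hstar
  refine ⟨e₁, e₂, ?_⟩
  rw [e₁, e₂]
  exact employ_lt_of_mem_Rb hBg h₁ h₁₂
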